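/- arXiv:0705.4423 — 8 statements merged into one kernel-verified Lean document; each statement's English description precedes it below -/
import Mathlib

section
/- Let N ≥ 1 and let A be a symmetric N×N matrix with integer entries. Suppose x_1, …, x_N are complex numbers such that x_i ≠ 0 and 1 − x_i ≠ 0 for every i, and such that ∏_{j=1}^N x_j^{A_{ij}} = 1 − x_i for every i. Then Σ_{i=1}^N x_i ∧ (1 − x_i) = 0 in the second exterior power Λ²_ℤ(ℂ^×) of the multiplicative group ℂ^× of nonzero complex numbers, regarded as a ℤ-module (written additively), where x ∧ y denotes the image of x ⊗ y in Λ²_ℤ(ℂ^×). -/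
/-- If `A` is a symmetric integer matrix and the nonzero complex numbers
`x i` (with `1 - x i ≠ 0`) satisfy `∏ j, x j ^ A i j = 1 - x i` for all `i`, then
`∑ i, x i ∧ (1 - x i) = 0` in the second exterior power `Λ²_ℤ(ℂˣ)` (realized as the
degree-2 component of the exterior algebra of the ℤ-module `Additive ℂˣ`, in which it
embeds; the wedge `x ∧ y` is `ι x * ι y`). -/
theorem stmt0 (N : ℕ) (hN : 1 ≤ N) (A : Matrix (Fin N) (Fin N) ℤ)
    (hA : A.IsSymm) (x : Fin N → ℂ)
    (hx0 : ∀ i, x i ≠ 0) (hx1 : ∀ i, 1 - x i ≠ 0)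
    (heq : ∀ i, ∏ j, x j ^ A i j = 1 - x i) :
    ∑ i, (ExteriorAlgebra.ι ℤ (Additive.ofMul (Units.mk0 (x i) (hx0 i))) *
        ExteriorAlgebra.ι ℤ (Additive.ofMul (Units.mk0 (1 - x i) (hx1 i)))
        : ExteriorAlgebra ℤ (Additive ℂˣ)) = 0 := by
  have h1 : ∀ i, Additive.ofMul (Units.mk0 (1 - x i) (hx1 i)) =
      ∑ j, A i j • Additive.ofMul (Units.mk0 (x j) (hx0 j)) := by
    intro i
    apply Additive.toMul.injective
    rw [toMul_sum]
    apply Units.ext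
    simp [toMul_zsmul, Units.coe_prod, heq]
  simp only [h1, map_sum, map_zsmul, Finset.mul_sum, mul_smul_comm]
  rw [← Finset.sum_product']
  refine Finset.sum_involution (fun p _ => (p.2, p.1)) ?_ ?_ (by simp) (by simp)
  · rintro ⟨i, j⟩ _
    dsimp only
    rw [hA.apply i j, ← smul_add, ExteriorAlgebra.ι_add_mul_swap, smul_zero]
  · rintro ⟨i, j⟩ _ hne heq'
    apply hne
    simp only [Prod.mk.injEq] at heq'
    obtain ⟨rfl, _⟩ := heq'
    simp [ExteriorAlgebra.ι_sq_zero]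
end

section
/- Let m ≥ 2 and let a_1, …, a_m be nonzero complex numbers. Then ∏_{k=1}^m A_k = (−1)^{m(m−1)²/2} · (∏_{1 ≤ j < i ≤ m} (a_i a_j − 1)^{m−2} (a_i − a_j)^{m−2}) / (∏_{i=1}^m a_i^{(m−1)(m−2)}). -/
/-- `A_k = (−1)^{k−1} (∏_{t≠k} a_t^{2−m}) · ∏_{i<j, i≠k, j≠k} (a_i a_j − 1)(a_i − a_j)`
(indices here are 0-based, so the prefactor is `(−1)^k` for `k : Fin m`). -/
noncomputable def Acoef (m : ℕ) (a : Fin m → ℂ) (k : Fin m) : ℂ :=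
  (-1 : ℂ) ^ (k : ℕ) * (∏ t ∈ Finset.univ.erase k, a t ^ (2 - (m : ℤ))) *
    ∏ i ∈ Finset.univ.erase k, ∏ j ∈ (Finset.Ioi i).erase k,
      ((a i * a j - 1) * (a i - a j))

/-- A product over all `k` of a pair product omitting `k` is the `(m-2)`-th power. -/
lemma prod_omit_aux (m : ℕ) (f : Fin m → Fin m → ℂ) :
    ∏ k, ∏ i ∈ Finset.univ.erase k, ∏ j ∈ (Finset.Ioi i).erase k, f i j =
      ∏ i, ∏ j ∈ Finset.Iio i, f j i ^ (m - 2) := by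
  have h1 : ∀ k : Fin m, ∏ i ∈ Finset.univ.erase k, ∏ j ∈ (Finset.Ioi i).erase k, f i j =
      ∏ i, ∏ j ∈ Finset.Ioi i, if k ≠ i ∧ k ≠ j then f i j else 1 := by
    intro k
    rw [← Finset.filter_ne, Finset.prod_filter]
    refine Finset.prod_congr rfl fun i _ => ?_
    split_ifs with h
    · rw [← Finset.filter_ne, Finset.prod_filter]
      refine Finset.prod_congr rfl fun j _ => ?_
      simp [h]
    · simp [h]
  rw [Finset.prod_congr rfl fun k _ => h1 k, Finset.prod_comm]
  have h2 : ∀ i : Fin m, ∏ k : Fin m, ∏ j ∈ Finset.Ioi i,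
      (if k ≠ i ∧ k ≠ j then f i j else 1) = ∏ j ∈ Finset.Ioi i, f i j ^ (m - 2) := by
    intro i
    rw [Finset.prod_comm]
    refine Finset.prod_congr rfl fun j hj => ?_
    rw [← Finset.prod_filter, Finset.prod_const]
    congr 1
    have hij : i ≠ j := (Finset.mem_Ioi.mp hj).ne
    have : (Finset.univ.filter fun k : Fin m => k ≠ i ∧ k ≠ j) = ({i, j} : Finset (Fin m))ᶜ := by
      ext k; simp
    rw [this, Finset.card_compl, Finset.card_pair hij, Fintype.card_fin]
  rw [Finset.prod_congr rfl fun i _ => h2 i]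
  refine Finset.prod_comm' ?_
  intro x y
  simp

/-- The product over all `k` of the products omitting `k`. -/
lemma prod_erase_aux (m : ℕ) (g : Fin m → ℂ) :
    ∏ k, ∏ t ∈ Finset.univ.erase k, g t = ∏ t, g t ^ (m - 1) := by
  have h1 : ∀ k : Fin m, ∏ t ∈ Finset.univ.erase k, g t = ∏ t, if k ≠ t then g t else 1 := by
    intro k
    rw [← Finset.filter_ne, Finset.prod_filter]
  rw [Finset.prod_congr rfl fun k _ => h1 k, Finset.prod_comm]
  refine Finset.prod_congr rfl fun t _ => ?_
  rw [← Finset.prod_filter, Finset.prod_const, Finset.filter_ne',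
    Finset.card_erase_of_mem (Finset.mem_univ t), Finset.card_univ, Fintype.card_fin]

/-- `∏_{k=1}^m A_k = (−1)^{m(m−1)²/2} ·
(∏_{j<i} (a_i a_j − 1)^{m−2} (a_i − a_j)^{m−2}) / (∏ i, a_i^{(m−1)(m−2)})`. -/
theorem stmt4 (m : ℕ) (hm : 2 ≤ m) (a : Fin m → ℂ) (ha : ∀ i, a i ≠ 0) :
    ∏ k, Acoef m a k =
      (-1 : ℂ) ^ (m * (m - 1) ^ 2 / 2) *
        (∏ i, ∏ j ∈ Finset.Iio i,
          ((a i * a j - 1) ^ (m - 2) * (a i - a j) ^ (m - 2))) /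
        ∏ i, a i ^ ((m - 1) * (m - 2)) := by
  unfold Acoef
  rw [Finset.prod_mul_distrib, Finset.prod_mul_distrib, prod_erase_aux,
    prod_omit_aux m fun i j => (a i * a j - 1) * (a i - a j)]
  have h1 : ∏ t, (a t ^ (2 - (m : ℤ))) ^ (m - 1) = (∏ i, a i ^ ((m - 1) * (m - 2)))⁻¹ := by
    rw [← Finset.prod_inv_distrib]
    refine Finset.prod_congr rfl fun t _ => ?_
    have : (2 - (m : ℤ)) = -((m - 2 : ℕ) : ℤ) := by omega
    rw [this, zpow_neg, zpow_natCast, inv_pow, ← pow_mul, mul_comm (m - 2)]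
  have h2 : ∏ i : Fin m, ∏ j ∈ Finset.Iio i, ((a j * a i - 1) * (a j - a i)) ^ (m - 2) =
      (∏ i : Fin m, (-1 : ℂ) ^ ((m - 2) * (i : ℕ))) * ∏ i, ∏ j ∈ Finset.Iio i,
          ((a i * a j - 1) ^ (m - 2) * (a i - a j) ^ (m - 2)) := by
    rw [← Finset.prod_mul_distrib]
    refine Finset.prod_congr rfl fun i _ => ?_
    have h3 : (-1 : ℂ) ^ ((m - 2) * (i : ℕ)) = ∏ j ∈ Finset.Iio i, (-1 : ℂ) ^ (m - 2) := by
      rw [Finset.prod_const, Fin.card_Iio, pow_mul]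
    rw [h3, ← Finset.prod_mul_distrib]
    refine Finset.prod_congr rfl fun j _ => ?_
    rw [← mul_pow, ← mul_pow]
    congr 1
    ring
  have h4 : (∏ k : Fin m, (-1 : ℂ) ^ (k : ℕ)) * (∏ i : Fin m, (-1 : ℂ) ^ ((m - 2) * (i : ℕ))) =
      (-1 : ℂ) ^ (m * (m - 1) ^ 2 / 2) := by
    rw [Finset.prod_pow_eq_pow_sum, Finset.prod_pow_eq_pow_sum, ← pow_add, ← Finset.mul_sum,
      Fin.sum_univ_eq_sum_range (fun i => i) m]
    congr 1
    have h5 := Finset.sum_range_id_mul_two m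
    obtain ⟨n, rfl⟩ : ∃ n, m = n + 2 := ⟨m - 2, by omega⟩
    symm
    apply Nat.div_eq_of_eq_mul_left (by norm_num)
    simp only [Nat.add_sub_cancel, show n + 2 - 1 = n + 1 by omega] at h5 ⊢
    linear_combination (n + 1) * h5.symm
  rw [h1, h2, ← h4, div_eq_mul_inv]
  ring
end

section
/- Let m ≥ 1 and let a_1, …, a_m be nonzero complex numbers. Let M be the m×m matrix whose first row has all entries equal to 1 and whose k-th row, for 2 ≤ k ≤ m, has j-th entry a_j^{k−1} + a_j^{1−k}. Then (∏_{i=1}^m a_i^{m−1}) · det M = ∏_{1 ≤ j < i ≤ m} (a_i − a_j)(a_i a_j − 1). -/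
open Polynomial in
theorem dick_aux (n : ℕ) : IsMonicOfDegree (dickson 1 (1 : ℂ) (n + 1)) (n + 1) ∧
    IsMonicOfDegree (dickson 1 (1 : ℂ) (n + 2)) (n + 2) := by
  have key : ∀ k : ℕ, IsMonicOfDegree (dickson 1 (1 : ℂ) (k + 1)) (k + 1) →
      (dickson 1 (1 : ℂ) k).natDegree < k + 2 →
      IsMonicOfDegree (dickson 1 (1 : ℂ) (k + 2)) (k + 2) := by
    intro k h1 h2
    rw [dickson_add_two, map_one, one_mul]
    have h3 : IsMonicOfDegree (X * dickson 1 (1 : ℂ) (k + 1)) (k + 2) := by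
      have := (isMonicOfDegree_X ℂ).mul h1
      rwa [show 1 + (k + 1) = k + 2 by ring] at this
    exact h3.sub h2
  induction n with
  | zero =>
    have h1 : IsMonicOfDegree (dickson 1 (1 : ℂ) (0 + 1)) (0 + 1) := by
      simpa using isMonicOfDegree_X ℂ
    refine ⟨h1, key 0 h1 ?_⟩
    have : dickson 1 (1 : ℂ) 0 = C 2 := by
      rw [dickson_zero, C_ofNat]; norm_num
    rw [this, natDegree_C]; norm_num
  | succ n ih =>
    refine ⟨ih.2, key (n + 1) ih.2 ?_⟩
    rw [ih.1.natDegree_eq]; omega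

theorem prod_aux (m : ℕ) (a : Fin m → ℂ) :
    ∏ i, a i ^ (m - 1) = ∏ i, ∏ j ∈ Finset.Iio i, (a i * a j) := by
  simp_rw [Finset.prod_mul_distrib]
  rw [Finset.prod_comm' (s := Finset.univ) (t := fun i : Fin m => Finset.Iio i)
    (t' := Finset.univ) (s' := fun j : Fin m => Finset.Ioi j) (f := fun _ j => a j) (by simp)]
  rw [← Finset.prod_mul_distrib]
  refine Finset.prod_congr rfl fun i _ => ?_
  simp only [Finset.prod_const, Fin.card_Iio, Fin.card_Ioi]
  rw [← pow_add]
  congr 1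
  omega

open Polynomial in
theorem det_aux (m : ℕ) (a : Fin m → ℂ) (ha : ∀ i, a i ≠ 0) :
      (Matrix.of fun k j : Fin m =>
        if (k : ℕ) = 0 then (1 : ℂ)
        else a j ^ ((k : ℕ) : ℤ) + a j ^ (-((k : ℕ) : ℤ))).det =
      ∏ i, ∏ j ∈ Finset.Iio i, ((a i + (a i)⁻¹) - (a j + (a j)⁻¹)) := by
  have hp : ∀ i : Fin m, IsMonicOfDegree
      (if (i : ℕ) = 0 then (1 : ℂ[X]) else dickson 1 (1 : ℂ) i) i := by
    intro i
    rcases hi : (i : ℕ) with _ | n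
    · simp
    · simpa using (dick_aux n).1
  have h := Matrix.det_eval_matrixOfPolynomials_eq_det_vandermonde
    (fun i => a i + (a i)⁻¹) _ (fun i => (hp i).natDegree_eq) (fun i => (hp i).monic)
  rw [Matrix.det_vandermonde, ← Matrix.det_transpose] at h
  rw [Finset.prod_comm' (s := Finset.univ) (t := fun i : Fin m => Finset.Iio i)
    (t' := Finset.univ) (s' := fun j : Fin m => Finset.Ioi j) (by simp), h]
  congr 1
  ext k j
  simp only [Matrix.of_apply, Matrix.transpose_apply]
  split_ifs with hk
  · simp
  · rw [dickson_one_one_eval_add_inv _ _ (mul_inv_cancel₀ (ha j))]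
    simp

/-- with `M` the `m×m` matrix whose first row is all 1's and whose
`k`-th row (`2 ≤ k ≤ m`) has `j`-th entry `a_j^{k−1} + a_j^{1−k}` (0-based: row `k`
has entries `a_j^k + a_j^{−k}` for `k ≥ 1`),
`(∏ i, a_i^{m−1}) · det M = ∏_{j<i} (a_i − a_j)(a_i a_j − 1)`. -/
theorem stmt5 (m : ℕ) (hm : 1 ≤ m) (a : Fin m → ℂ) (ha : ∀ i, a i ≠ 0) :
    (∏ i, a i ^ (m - 1)) *
      (Matrix.of fun k j : Fin m =>
        if (k : ℕ) = 0 then (1 : ℂ)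
        else a j ^ ((k : ℕ) : ℤ) + a j ^ (-((k : ℕ) : ℤ))).det =
      ∏ i, ∏ j ∈ Finset.Iio i, ((a i - a j) * (a i * a j - 1)) := by

  rw [det_aux m a ha, prod_aux, ← Finset.prod_mul_distrib]
  refine Finset.prod_congr rfl fun i _ => ?_
  rw [← Finset.prod_mul_distrib]
  refine Finset.prod_congr rfl fun j _ => ?_
  have hi := ha i
  have hj := ha j
  field_simp
  ring
end

section
/- Let m ≥ 2 and let a_1, …, a_m be nonzero complex numbers. Then for every integer j with 2 ≤ j ≤ m, Σ_{k=1}^m (a_k^{m−j} + a_k^{j−m}) · A_k = 0. -/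
open Polynomial in
lemma exists_poly (d : ℕ) : ∃ q : ℂ[X], q.natDegree ≤ d ∧
    ∀ a : ℂ, a ≠ 0 → q.eval (-(a + a⁻¹)) = a ^ d + a⁻¹ ^ d := by
  induction d using Nat.strong_induction_on with
  | _ d ih =>
    match d, ih with
    | 0, _ => exact ⟨C 2, by simp, fun a _ => by simp; norm_num⟩
    | 1, _ => exact ⟨-X, by simp, fun a _ => by simp⟩
    | d + 2, ih =>
      obtain ⟨p, hp, hp'⟩ := ih d (by omega)
      obtain ⟨q, hq, hq'⟩ := ih (d + 1) (by omega)
      refine ⟨-X * q - p, ?_, fun a h => ?_⟩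
      · refine (natDegree_sub_le _ _).trans (max_le ?_ (by omega))
        refine natDegree_mul_le.trans ?_
        simp only [natDegree_neg, natDegree_X]
        omega
      · rw [eval_sub, eval_mul, hp' a h, hq' a h, eval_neg, eval_X]
        have : a * a⁻¹ = 1 := mul_inv_cancel₀ h
        linear_combination (a ^ d + a⁻¹ ^ d) * this

open Polynomial in
lemma det_sum_zero (n : ℕ) (y : Fin (n + 1) → ℂ) (q : ℂ[X]) (hq : q.natDegree < n) :
    ∑ k : Fin (n + 1), (-1 : ℂ) ^ (k : ℕ) * q.eval (y k) *
      ∏ i : Fin n, ∏ j ∈ Finset.Ioi i, (y (k.succAbove j) - y (k.succAbove i)) = 0 := by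
  let M : Matrix (Fin (n + 1)) (Fin (n + 1)) ℂ :=
    fun i => Fin.cons (q.eval (y i)) (fun c : Fin n => y i ^ (c : ℕ))
  have h0 : M.det = 0 := by
    rw [← Matrix.exists_mulVec_eq_zero_iff]
    refine ⟨Fin.cons 1 (fun c : Fin n => - q.coeff c), ?_, ?_⟩
    · intro h
      have := congrFun h 0
      simp at this
    · ext i
      simp only [Matrix.mulVec, dotProduct, Fin.sum_univ_succ, M, Fin.cons_zero, Fin.cons_succ,
        Pi.zero_apply]
      rw [eval_eq_sum_range' hq, ← Fin.sum_univ_eq_sum_range (fun c => q.coeff c * y i ^ c),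
        mul_one, ← Finset.sum_add_distrib]
      exact Finset.sum_eq_zero fun c _ => by ring
  rw [Matrix.det_succ_column_zero] at h0
  rw [← h0]
  refine Finset.sum_congr rfl fun k _ => ?_
  have : M.submatrix k.succAbove Fin.succ = Matrix.vandermonde (fun i => y (k.succAbove i)) := by
    ext i c
    rw [Matrix.submatrix_apply, Matrix.vandermonde_apply]
    simp only [M, Fin.cons_succ]
  rw [this, Matrix.det_vandermonde]
  simp [M]

lemma prod_pairs (n : ℕ) (b : Fin n → ℂ) :
    ∏ i : Fin n, ∏ j ∈ Finset.Ioi i, (b i * b j) = ∏ i, b i ^ (n - 1) := by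
  simp only [Finset.prod_mul_distrib]
  rw [Finset.prod_comm' (t' := Finset.univ) (s' := fun j => Finset.Iio j)
    (f := fun i j => b j) (by simp)]
  rw [← Finset.prod_mul_distrib]
  refine Finset.prod_congr rfl fun i _ => ?_
  rw [Finset.prod_const, Finset.prod_const, Fin.card_Ioi, Fin.card_Iio, ← pow_add]
  congr 1
  omega

lemma prod_erase_succAbove (n : ℕ) (k : Fin (n + 1)) (s : Finset (Fin (n + 1)))
    (f : Fin (n + 1) → ℂ) :
    ∏ t ∈ s.erase k, f t =
      ∏ i ∈ Finset.univ.filter (fun i : Fin n => k.succAbove i ∈ s), f (k.succAbove i) := by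
  symm
  refine Finset.prod_bij (fun i _ => k.succAbove i) ?_ ?_ ?_ ?_
  · intro i hi
    simpa [Fin.succAbove_ne] using hi
  · intro i _ j _ h
    exact Fin.succAbove_right_injective h
  · intro t ht
    rw [Finset.mem_erase] at ht
    obtain ⟨i, rfl⟩ := Fin.exists_succAbove_eq ht.1
    exact ⟨i, by simpa using ht.2, rfl⟩
  · intros; rfl

lemma Acoef_eq (n : ℕ) (hn : 1 ≤ n) (a : Fin (n + 1) → ℂ) (ha : ∀ i, a i ≠ 0) (k : Fin (n + 1)) :
    Acoef (n + 1) a k = (-1 : ℂ) ^ (k : ℕ) * ∏ i : Fin n, ∏ j ∈ Finset.Ioi i,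
      (-(a (k.succAbove j) + (a (k.succAbove j))⁻¹)
        - -(a (k.succAbove i) + (a (k.succAbove i))⁻¹)) := by
  unfold Acoef
  simp only [prod_erase_succAbove, Finset.mem_univ, Finset.filter_true, Finset.mem_Ioi,
    (Fin.strictMono_succAbove k).lt_iff_lt]
  have hI : ∀ i : Fin n, Finset.univ.filter (fun j => i < j) = Finset.Ioi i := by
    intro i; ext j; simp
  simp only [hI]
  have hf : ∀ i j : Fin n, (a (k.succAbove i) * a (k.succAbove j) - 1) *
      (a (k.succAbove i) - a (k.succAbove j)) =
      (a (k.succAbove i) * a (k.succAbove j)) *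
       (-(a (k.succAbove j) + (a (k.succAbove j))⁻¹)
        - -(a (k.succAbove i) + (a (k.succAbove i))⁻¹)) := by
    intro i j
    have h1 := ha (k.succAbove i)
    have h2 := ha (k.succAbove j)
    field_simp
    ring
  simp only [hf]
  have hp := prod_pairs n (fun i => a (k.succAbove i))
  have hc : (∏ i : Fin n, a (k.succAbove i) ^ (2 - ((n + 1 : ℕ) : ℤ))) *
      ∏ i : Fin n, a (k.succAbove i) ^ (n - 1) = 1 := by
    rw [← Finset.prod_mul_distrib]
    refine Finset.prod_eq_one fun i _ => ?_
    rw [← zpow_natCast, ← zpow_add₀ (ha _)]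
    have : (2 - ((n + 1 : ℕ) : ℤ)) + ((n - 1 : ℕ) : ℤ) = 0 := by omega
    rw [this, zpow_zero]
  have hsplit : ∀ f g : Fin n → Fin n → ℂ, ∏ i : Fin n, ∏ j ∈ Finset.Ioi i, (f i j * g i j) =
      (∏ i : Fin n, ∏ j ∈ Finset.Ioi i, f i j) * ∏ i : Fin n, ∏ j ∈ Finset.Ioi i, g i j := by
    intro f g
    simp only [Finset.prod_mul_distrib]
  rw [hsplit (fun i j => a (k.succAbove i) * a (k.succAbove j)), hp]
  rw [mul_assoc, ← mul_assoc (∏ i : Fin n, _) (∏ i : Fin n, _), hc, one_mul]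

/-- for every integer `j` with `2 ≤ j ≤ m`,
`Σ_{k=1}^m (a_k^{m−j} + a_k^{j−m}) · A_k = 0`. -/
theorem stmt6 (m : ℕ) (hm : 2 ≤ m) (a : Fin m → ℂ) (ha : ∀ i, a i ≠ 0)
    (j : ℤ) (hj1 : 2 ≤ j) (hj2 : j ≤ (m : ℤ)) :
    ∑ k, (a k ^ ((m : ℤ) - j) + a k ^ (j - (m : ℤ))) * Acoef m a k = 0 := by
  obtain ⟨n, rfl⟩ : ∃ n, m = n + 1 := ⟨m - 1, by omega⟩
  obtain ⟨d, hd⟩ : ∃ d : ℕ, ((n + 1 : ℕ) : ℤ) - j = d := ⟨(((n + 1 : ℕ) : ℤ) - j).toNat, by omega⟩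
  have hd' : j - ((n + 1 : ℕ) : ℤ) = -(d : ℤ) := by omega
  obtain ⟨q, hq, hq'⟩ := exists_poly d
  rw [← det_sum_zero n (fun i => -(a i + (a i)⁻¹)) q (by omega)]
  refine Finset.sum_congr rfl fun k _ => ?_
  rw [Acoef_eq n (by omega) a ha k, hd, hd', hq' _ (ha k), zpow_neg, zpow_natCast, inv_pow]
  ring
end

section
/- Let r ≥ 2 and let a_1, …, a_r be nonzero complex numbers. For an integer i, let N_i denote the D_r-alternating sum S((r−1+i, r−2, r−3, …, 1, 0)), i.e. the sum over the exponent vector obtained from the Weyl vector ρ = (r−1, r−2, …, 1, 0) by adding i to the first entry. Then N_0 = N_{2−2r} = S(ρ), and N_i = 0 for every i ∈ {−1, −2, …, 3−2r}. -/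
/-- The `D_m`-alternating sum `S(c) = Σ_{(σ,ε)∈W(D_m)} sgn(σ) ∏ i, a i ^ (ε i * c (σ i))`,
where `W(D_m)` consists of pairs of a permutation `σ` of `{1,…,m}` and a sign vector
`ε ∈ {±1}^m` with `∏ i, ε i = 1`. -/
noncomputable def DSum (m : ℕ) (a : Fin m → ℂ) (c : Fin m → ℤ) : ℂ :=
  ∑ σ : Equiv.Perm (Fin m),
    ∑ ε ∈ Finset.univ.filter (fun ε : Fin m → ℤˣ => ∏ i, ε i = 1),
      ((Equiv.Perm.sign σ : ℤ) : ℂ) * ∏ i, a i ^ ((ε i : ℤ) * c (σ i))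

/-- The exponent vector `(r−1+i, r−2, r−3, …, 1, 0)` obtained from the Weyl vector
`ρ = (r−1, r−2, …, 1, 0)` of `D_r` by adding `i` to the first entry. -/
def cvec (r : ℕ) (i : ℤ) : Fin r → ℤ :=
  fun k => if (k : ℕ) = 0 then (r : ℤ) - 1 + i else (r : ℤ) - 1 - (k : ℕ)

theorem DSum_perm (m : ℕ) (a : Fin m → ℂ) (c : Fin m → ℤ) (τ : Equiv.Perm (Fin m)) :
    DSum m a (fun k => c (τ k)) = ((Equiv.Perm.sign τ : ℤ) : ℂ) * DSum m a c := by
  unfold DSum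
  rw [Finset.mul_sum]
  symm
  rw [← Equiv.sum_comp (Equiv.mulLeft τ)]
  refine Finset.sum_congr rfl fun σ _ => ?_
  rw [Finset.mul_sum]
  refine Finset.sum_congr rfl fun ε _ => ?_
  simp only [Equiv.coe_mulLeft, Equiv.Perm.sign_mul, Equiv.Perm.mul_apply]
  rcases Int.units_eq_one_or (Equiv.Perm.sign τ) with h | h <;> simp [h]

theorem DSum_eq_zero (m : ℕ) (a : Fin m → ℂ) (c : Fin m → ℤ) (k l : Fin m) (hkl : k ≠ l)
    (h : c k = c l) : DSum m a c = 0 := by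
  have h1 := DSum_perm m a c (Equiv.swap k l)
  have h2 : (fun j => c (Equiv.swap k l j)) = c := by
    funext j
    rw [Equiv.swap_apply_def]
    split_ifs with h3 h4
    · rw [h3, h]
    · rw [h4, h]
    · rfl
  rw [h2, Equiv.Perm.sign_swap hkl] at h1
  push_cast at h1
  linear_combination h1 / 2

theorem DSum_signs (m : ℕ) (a : Fin m → ℂ) (c : Fin m → ℤ) (η : Fin m → ℤˣ)
    (hη : ∏ i, η i = 1) : DSum m a (fun k => (η k : ℤ) * c k) = DSum m a c := by
  unfold DSum
  refine Finset.sum_congr rfl fun σ _ => ?_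
  have hs : ∏ i, η (σ i) = 1 := by rw [Equiv.prod_comp σ η, hη]
  refine Finset.sum_bij' (fun ε _ => fun i => ε i * η (σ i)) (fun ε _ => fun i => ε i * η (σ i))
    ?_ ?_ ?_ ?_ ?_
  · intro ε hε
    simpa [Finset.prod_mul_distrib, hs] using hε
  · intro ε hε
    simpa [Finset.prod_mul_distrib, hs] using hε
  · intro ε _
    funext i
    simp [mul_assoc]
  · intro ε _
    funext i
    simp [mul_assoc]
  · intro ε _
    simp [mul_assoc]

theorem DSum_flip (m : ℕ) (a : Fin m → ℂ) (c d : Fin m → ℤ) (k l : Fin m) (hkl : k ≠ l)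
    (hk : d k = - c k) (hl : d l = - c l) (h : ∀ j, j ≠ k → j ≠ l → d j = c j) :
    DSum m a d = DSum m a c := by
  rw [← DSum_signs m a c (fun j => (if j = k then (-1 : ℤˣ) else 1) * (if j = l then (-1 : ℤˣ) else 1))]
  · congr 1
    funext j
    by_cases h1 : j = k
    · subst h1
      simp [hk, hkl]
    · by_cases h2 : j = l
      · subst h2
        simp [hl, h1]
      · simp [h j h1 h2, h1, h2]
  · rw [Finset.prod_mul_distrib]
    simp

/-- with `N_i = S((r−1+i, r−2, …, 1, 0))` and `ρ = (r−1, r−2, …, 1, 0)`,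
one has `N_0 = S(ρ)`, `N_{2−2r} = S(ρ)`, and `N_i = 0` for `i = −1, −2, …, 3−2r`. -/
theorem stmt7 (r : ℕ) (hr : 2 ≤ r) (a : Fin r → ℂ) (ha : ∀ i, a i ≠ 0) :
    DSum r a (cvec r 0) = DSum r a (fun k => (r : ℤ) - 1 - (k : ℕ)) ∧
    DSum r a (cvec r (2 - 2 * (r : ℤ))) = DSum r a (fun k => (r : ℤ) - 1 - (k : ℕ)) ∧
    ∀ i : ℤ, 3 - 2 * (r : ℤ) ≤ i → i ≤ -1 → DSum r a (cvec r i) = 0 := by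
  have h0 : ∀ j : Fin r, j ≠ ⟨0, by omega⟩ → (j : ℕ) ≠ 0 := fun j hj h => hj (Fin.ext h)
  have hne : (⟨0, by omega⟩ : Fin r) ≠ ⟨r - 1, by omega⟩ := by
    intro h
    have := congrArg Fin.val h
    simp only at this
    omega
  refine ⟨?_, ?_, ?_⟩
  · congr 1
    funext k
    unfold cvec
    split_ifs with h
    · simp [h]
    · rfl
  · refine DSum_flip r a _ _ ⟨0, by omega⟩ ⟨r - 1, by omega⟩ hne ?_ ?_ ?_
    · simp only [cvec, if_true]
      push_cast
      ring
    · simp only [cvec]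
      rw [if_neg (by omega)]
      omega
    · intro j hj _
      simp only [cvec]
      rw [if_neg (h0 j hj)]
  · have key : ∀ i : ℤ, 1 - (r : ℤ) ≤ i → i ≤ -1 → DSum r a (cvec r i) = 0 := by
      intro i h1 h2
      have hlt : (-i).toNat < r := by omega
      refine DSum_eq_zero r a _ ⟨0, by omega⟩ ⟨(-i).toNat, hlt⟩ ?_ ?_
      · intro h
        have := congrArg Fin.val h
        simp only at this
        omega
      · simp only [cvec, if_true]
        rw [if_neg (by omega)]
        omega
    intro i h1 h2
    by_cases h3 : 1 - (r : ℤ) ≤ i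
    · exact key i h3 h2
    · rw [← key (2 - 2 * (r : ℤ) - i) (by omega) (by omega)]
      refine DSum_flip r a _ _ ⟨0, by omega⟩ ⟨r - 1, by omega⟩ hne ?_ ?_ ?_
      · simp only [cvec, if_true]
        ring
      · simp only [cvec]
        rw [if_neg (by omega), if_neg (by omega)]
        omega
      · intro j hj _
        simp only [cvec]
        rw [if_neg (h0 j hj), if_neg (h0 j hj)]
end

section
/- Let m ≥ 2 and let a_1, …, a_m be nonzero complex numbers. Let B be the m×m matrix whose first row has j-th entry A_j and whose k-th row, for 2 ≤ k ≤ m, has j-th entry (a_j^{k−1} + a_j^{1−k})·A_j. Then det B = (∏_{j=1}^m A_j) · (∏_{1 ≤ j < i ≤ m} (a_i − a_j)(a_i a_j − 1)) / (∏_{i=1}^m a_i^{m−1}). In particular, if a_i ≠ a_j and a_i a_j ≠ 1 for all i ≠ j, then det B ≠ 0. -/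
/-- The matrix `B` whose first row has `j`-th entry `A_j` and whose `k`-th row
(`2 ≤ k ≤ m`) has `j`-th entry `(a_j^{k−1} + a_j^{1−k})·A_j`. -/
noncomputable def Bmat (m : ℕ) (a : Fin m → ℂ) : Matrix (Fin m) (Fin m) ℂ :=
  Matrix.of fun k j =>
    if (k : ℕ) = 0 then Acoef m a j
    else (a j ^ ((k : ℕ) : ℤ) + a j ^ (-((k : ℕ) : ℤ))) * Acoef m a j

theorem cheb_aux (n : ℕ) :
    (Polynomial.Chebyshev.C ℂ (n : ℤ)).natDegree ≤ n ∧
    (Polynomial.Chebyshev.C ℂ ((n + 1 : ℕ) : ℤ)).natDegree = n + 1 ∧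
    (Polynomial.Chebyshev.C ℂ ((n + 1 : ℕ) : ℤ)).Monic := by
  induction n with
  | zero =>
    refine ⟨?_, ?_, ?_⟩
    · have : (2 : Polynomial ℂ) = Polynomial.C 2 := rfl
      simp [this]
    · simp
    · simpa using Polynomial.monic_X
  | succ n ih =>
    obtain ⟨h0, h1, h2⟩ := ih
    have hrec : Polynomial.Chebyshev.C ℂ ((n + 1 + 1 : ℕ) : ℤ) =
        Polynomial.X * Polynomial.Chebyshev.C ℂ ((n + 1 : ℕ) : ℤ) -
          Polynomial.Chebyshev.C ℂ (n : ℤ) := by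
      have := Polynomial.Chebyshev.C_add_two ℂ (n : ℤ)
      push_cast
      rw [← this]
      congr 1
    have hm : (Polynomial.X * Polynomial.Chebyshev.C ℂ ((n + 1 : ℕ) : ℤ)).Monic :=
      Polynomial.monic_X.mul h2
    have hd : (Polynomial.X * Polynomial.Chebyshev.C ℂ ((n + 1 : ℕ) : ℤ)).natDegree
        = n + 1 + 1 := by
      rw [Polynomial.monic_X.natDegree_mul h2, h1, Polynomial.natDegree_X]; ring
    refine ⟨h1.le, ?_, ?_⟩
    · rw [hrec, Polynomial.natDegree_sub_eq_left_of_natDegree_lt (by omega), hd]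
    · rw [hrec]
      exact hm.sub_of_left (Polynomial.degree_lt_degree (by omega))

theorem cheb_eval (x : ℂ) (hx : x ≠ 0) (n : ℕ) :
    (Polynomial.Chebyshev.C ℂ (n : ℤ)).eval (x + x⁻¹) = x ^ n + (x⁻¹) ^ n ∧
    (Polynomial.Chebyshev.C ℂ ((n + 1 : ℕ) : ℤ)).eval (x + x⁻¹) =
      x ^ (n + 1) + (x⁻¹) ^ (n + 1) := by
  induction n with
  | zero => constructor <;> norm_num
  | succ n ih =>
    obtain ⟨h0, h1⟩ := ih
    refine ⟨h1, ?_⟩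
    have := Polynomial.Chebyshev.C_add_two ℂ (n : ℤ)
    have e : ((n + 1 + 1 : ℕ) : ℤ) = (n : ℤ) + 2 := by push_cast; ring
    have e1 : ((n + 1 : ℕ) : ℤ) = (n : ℤ) + 1 := by push_cast; ring
    rw [e1] at h1
    rw [e, this, Polynomial.eval_sub, Polynomial.eval_mul, Polynomial.eval_X, h0, h1]
    have hxx : x * x⁻¹ = 1 := mul_inv_cancel₀ hx
    linear_combination (x ^ n + x⁻¹ ^ n) * hxx

theorem pair_swap (m : ℕ) (f : Fin m → Fin m → ℂ) :
    ∏ i, ∏ j ∈ Finset.Ioi i, f j i = ∏ i, ∏ j ∈ Finset.Iio i, f i j := by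
  apply Finset.prod_comm'
  simp

theorem pair_prod (m : ℕ) (a : Fin m → ℂ) :
    ∏ i, ∏ j ∈ Finset.Iio i, (a i * a j) = ∏ i, a i ^ (m - 1) := by
  simp_rw [Finset.prod_mul_distrib]
  rw [← pair_swap m (fun _ j => a j), ← Finset.prod_mul_distrib]
  refine Finset.prod_congr rfl fun i _ => ?_
  simp only [Finset.prod_const, Fin.card_Iio, Fin.card_Ioi]
  rw [← pow_add]
  congr 1
  omega

theorem det_formula (m : ℕ) (a : Fin m → ℂ) (ha : ∀ i, a i ≠ 0) :
    (Bmat m a).det =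
      (∏ j, Acoef m a j) *
        (∏ i, ∏ j ∈ Finset.Iio i, ((a i - a j) * (a i * a j - 1))) /
        ∏ i, a i ^ (m - 1) := by
  let p : Fin m → Polynomial ℂ := fun k =>
    if (k : ℕ) = 0 then 1 else Polynomial.Chebyshev.C ℂ ((k : ℕ) : ℤ)
  have hp := Matrix.det_eval_matrixOfPolynomials_eq_det_vandermonde
    (fun i => a i + (a i)⁻¹) p
    (by
      rintro ⟨k, hk⟩
      cases k with
      | zero => simp [p]
      | succ n => simpa [p] using (cheb_aux n).2.1)
    (by
      rintro ⟨k, hk⟩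
      cases k with
      | zero => simp [p]
      | succ n => simpa [p] using (cheb_aux n).2.2)
  have hB : Bmat m a = Matrix.of fun k j => Acoef m a j *
      (Matrix.of (fun i j => ((p j).eval (a i + (a i)⁻¹)))).transpose k j := by
    ext k j
    by_cases hk : (k : ℕ) = 0
    · simp [Bmat, p, hk]
    · simp only [Bmat, p, hk, Matrix.of_apply, Matrix.transpose_apply, if_false]
      rw [(cheb_eval (a j) (ha j) k).1]
      simp [mul_comm]
  rw [hB, Matrix.det_mul_row, Matrix.det_transpose, ← hp, Matrix.det_vandermonde,
    pair_swap m (fun i j => (a i + (a i)⁻¹) - (a j + (a j)⁻¹)), mul_div_assoc, ← pair_prod,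
    ← Finset.prod_div_distrib]
  congr 1
  refine Finset.prod_congr rfl fun i _ => ?_
  rw [← Finset.prod_div_distrib]
  refine Finset.prod_congr rfl fun j _ => ?_
  have := ha i
  have := ha j
  field_simp
  ring

/-- `det B = (∏ j, A_j) · (∏_{j<i} (a_i − a_j)(a_i a_j − 1)) / ∏ i, a_i^{m−1}`;
in particular `det B ≠ 0` whenever `a_i ≠ a_j` and `a_i a_j ≠ 1` for all `i ≠ j`. -/
theorem stmt9 (m : ℕ) (hm : 2 ≤ m) (a : Fin m → ℂ) (ha : ∀ i, a i ≠ 0) :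
    (Bmat m a).det =
      (∏ j, Acoef m a j) *
        (∏ i, ∏ j ∈ Finset.Iio i, ((a i - a j) * (a i * a j - 1))) /
        ∏ i, a i ^ (m - 1) ∧
    ((∀ i j, i ≠ j → a i ≠ a j ∧ a i * a j ≠ 1) → (Bmat m a).det ≠ 0) := by
  refine ⟨det_formula m a ha, fun h => ?_⟩
  rw [det_formula m a ha]
  refine div_ne_zero (mul_ne_zero ?_ ?_) ?_
  · refine Finset.prod_ne_zero_iff.2 fun k _ => ?_
    refine mul_ne_zero (mul_ne_zero (pow_ne_zero _ (by norm_num)) ?_) ?_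
    · exact Finset.prod_ne_zero_iff.2 fun t _ => zpow_ne_zero _ (ha t)
    · refine Finset.prod_ne_zero_iff.2 fun i _ => Finset.prod_ne_zero_iff.2 fun j hj => ?_
      have hij : i ≠ j := (Finset.mem_Ioi.1 (Finset.mem_of_mem_erase hj)).ne
      exact mul_ne_zero (sub_ne_zero.2 (h i j hij).2) (sub_ne_zero.2 (h i j hij).1)
  · refine Finset.prod_ne_zero_iff.2 fun i _ => Finset.prod_ne_zero_iff.2 fun j hj => ?_
    have hij : i ≠ j := (Finset.mem_Iio.1 hj).ne'
    exact mul_ne_zero (sub_ne_zero.2 (h i j hij).1) (sub_ne_zero.2 (h i j hij).2)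
  · exact Finset.prod_ne_zero_iff.2 fun i _ => pow_ne_zero _ (ha i)
end

section
/- Let r ≥ 1 and let b_1, …, b_r be nonzero complex numbers. Let P_+ = Σ_{ε∈{±1}^r, ε_1⋯ε_r = +1} ∏_{i=1}^r b_i^{ε_i} and P_− = Σ_{ε∈{±1}^r, ε_1⋯ε_r = −1} ∏_{i=1}^r b_i^{ε_i}, and let e_k denote the k-th elementary symmetric polynomial evaluated at the 2r numbers b_1², b_1^{−2}, …, b_r², b_r^{−2} (with e_0 = 1). Then P_+ · P_− = e_{r−1} + e_{r−3} + e_{r−5} + ⋯, where the sum extends over all nonnegative indices r−1−2k ≥ 0. (This expresses the product of the two half-spinor characters of D_r as χ(ω_{r−1})·χ(ω_r) = Σ a_{i_1}⋯a_{i_{r−1}} + Q₁^{r−3}, with a_i = b_i².) -/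
/-- The half-spinor sum `P_s = Σ_{ε∈{±1}^r, ε_1⋯ε_r = s} ∏ i, b i ^ ε i`. -/
noncomputable def Pspin (r : ℕ) (b : Fin r → ℂ) (s : ℤˣ) : ℂ :=
  ∑ ε ∈ Finset.univ.filter (fun ε : Fin r → ℤˣ => ∏ i, ε i = s),
    ∏ i, b i ^ (ε i : ℤ)

/-- The `k`-th elementary symmetric polynomial evaluated at the `2r` numbers
`b_1², b_1^{−2}, …, b_r², b_r^{−2}` (indexed by `Fin r × Bool`). -/
noncomputable def esymm2r (r : ℕ) (b : Fin r → ℂ) (k : ℕ) : ℂ :=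
  ∑ t ∈ (Finset.univ : Finset (Fin r × Bool)).powersetCard k,
    ∏ p ∈ t, if p.2 then b p.1 ^ (2 : ℤ) else b p.1 ^ (-2 : ℤ)

/-- The entry attached to an index `p`. -/
noncomputable def aVal (r : ℕ) (b : Fin r → ℂ) (p : Fin r × Bool) : ℂ :=
  if p.2 then b p.1 ^ (2 : ℤ) else b p.1 ^ (-2 : ℤ)

lemma esymm_gen (r : ℕ) (b : Fin r → ℂ) (x : ℂ) :
    ∏ i, ((1 + x * b i ^ (2 : ℤ)) * (1 + x * b i ^ (-2 : ℤ))) =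
      ∑ k ∈ Finset.range (2 * r + 1), x ^ k * esymm2r r b k := by
  have h1 : ∏ i, ((1 + x * b i ^ (2 : ℤ)) * (1 + x * b i ^ (-2 : ℤ))) =
      ∏ p : Fin r × Bool, (1 + x * aVal r b p) := by
    rw [Fintype.prod_prod_type]
    refine Finset.prod_congr rfl fun i _ => ?_
    simp [aVal]
  rw [h1, Finset.prod_one_add, Finset.sum_powerset]
  have hc : (Finset.univ : Finset (Fin r × Bool)).card = 2 * r := by
    simp [mul_comm]
  rw [hc]
  refine Finset.sum_congr rfl fun k _ => ?_
  rw [esymm2r, Finset.mul_sum]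
  refine Finset.sum_congr rfl fun t ht => ?_
  rw [Finset.prod_mul_distrib, Finset.prod_const, (Finset.mem_powersetCard.1 ht).2]
  rfl

/-- Swap `b_i ^ 2` and `b_i ^ (-2)`. -/
def sw (r : ℕ) : Fin r × Bool ≃ Fin r × Bool :=
  Equiv.prodCongr (Equiv.refl _) Equiv.boolNot

lemma sw_sw (r : ℕ) (p : Fin r × Bool) : sw r (sw r p) = p := by
  rcases p with ⟨i, _ | _⟩ <;> rfl

lemma aVal_ne (r : ℕ) (b : Fin r → ℂ) (hb : ∀ i, b i ≠ 0) (p) : aVal r b p ≠ 0 := by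
  unfold aVal; split_ifs
  · exact zpow_ne_zero _ (hb _)
  · exact zpow_ne_zero _ (hb _)

lemma aVal_sw (r : ℕ) (b : Fin r → ℂ) (p) : aVal r b (sw r p) = (aVal r b p)⁻¹ := by
  rcases p with ⟨i, _ | _⟩ <;> simp [aVal, sw, zpow_neg]

lemma aVal_prod (r : ℕ) (b : Fin r → ℂ) (hb : ∀ i, b i ≠ 0) : ∏ p, aVal r b p = 1 := by
  rw [Fintype.prod_prod_type]
  refine Finset.prod_eq_one fun i _ => ?_
  have := hb i
  simp [aVal, zpow_neg]
  field_simp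

/-- Complement of the swapped set. -/
def cs (r : ℕ) (t : Finset (Fin r × Bool)) : Finset (Fin r × Bool) :=
  (t.map (sw r).toEmbedding)ᶜ

lemma mem_cs (r : ℕ) (t : Finset (Fin r × Bool)) (p) : p ∈ cs r t ↔ sw r p ∉ t := by
  rw [cs, Finset.mem_compl, Finset.mem_map_equiv]
  have : (sw r).symm p = sw r p := by
    rw [Equiv.symm_apply_eq, sw_sw]
  rw [this]

lemma cs_cs (r : ℕ) (t : Finset (Fin r × Bool)) : cs r (cs r t) = t := by
  ext p
  simp [mem_cs, sw_sw]

lemma card_cs (r : ℕ) (t : Finset (Fin r × Bool)) : (cs r t).card = 2 * r - t.card := by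
  simp [cs, Finset.card_compl, mul_comm]

lemma prod_cs (r : ℕ) (b : Fin r → ℂ) (hb : ∀ i, b i ≠ 0) (t : Finset (Fin r × Bool)) :
    ∏ p ∈ cs r t, aVal r b p = ∏ p ∈ t, aVal r b p := by
  have h := Finset.prod_mul_prod_compl (t.map (sw r).toEmbedding) (aVal r b)
  rw [aVal_prod r b hb, Finset.prod_map] at h
  simp only [Equiv.coe_toEmbedding, aVal_sw, Finset.prod_inv_distrib] at h
  have hne : ∏ p ∈ t, aVal r b p ≠ 0 := Finset.prod_ne_zero_iff.2 fun p _ => aVal_ne r b hb p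
  rw [inv_mul_eq_one₀ hne] at h
  exact h.symm

lemma esymm_pal (r : ℕ) (b : Fin r → ℂ) (hb : ∀ i, b i ≠ 0) (k : ℕ) (hk : k ≤ 2 * r) :
    esymm2r r b (2 * r - k) = esymm2r r b k := by
  unfold esymm2r
  refine Finset.sum_nbij' (cs r) (cs r) ?_ ?_ ?_ ?_ ?_
  · intro t ht
    have := (Finset.mem_powersetCard.1 ht).2
    refine Finset.mem_powersetCard.2 ⟨Finset.subset_univ _, ?_⟩
    rw [card_cs]; omega
  · intro t ht
    have := (Finset.mem_powersetCard.1 ht).2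
    refine Finset.mem_powersetCard.2 ⟨Finset.subset_univ _, ?_⟩
    rw [card_cs]; omega
  · intro t _; exact cs_cs r t
  · intro t _; exact cs_cs r t
  · intro t _; exact (prod_cs r b hb t).symm

lemma sum_even (h : ℕ → ℂ) (r : ℕ) :
    ∑ j ∈ Finset.range r, (1 + (-1) ^ j) * h j =
      2 * ∑ k ∈ Finset.range ((r + 1) / 2), h (2 * k) := by
  induction r with
  | zero => simp
  | succ n ih =>
    rw [Finset.sum_range_succ, ih]
    rcases Nat.even_or_odd' n with ⟨m, rfl | rfl⟩
    · have e1 : (2 * m + 1) / 2 = m := by omega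
      have e2 : (2 * m + 1 + 1) / 2 = m + 1 := by omega
      rw [e1, e2, Finset.sum_range_succ]
      simp [pow_mul]; ring
    · have e1 : (2 * m + 1 + 1) / 2 = m + 1 := by omega
      have e2 : (2 * m + 1 + 1 + 1) / 2 = m + 1 := by omega
      rw [e1, e2]
      simp [pow_succ, pow_mul]

lemma sum_units (f : ℤˣ → ℂ) : ∑ u : ℤˣ, f u = f 1 + f (-1) := by
  have : (Finset.univ : Finset ℤˣ) = {1, -1} := by decide
  rw [this, Finset.sum_pair (by decide)]

lemma spin_lin (r : ℕ) (b : Fin r → ℂ) (c : ℤˣ →* ℂ) :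
    ∏ i, (b i + c (-1) * (b i)⁻¹) = Pspin r b 1 + c (-1) * Pspin r b (-1) := by
  have h1 : ∏ i, (b i + c (-1) * (b i)⁻¹) = ∏ i, ∑ u : ℤˣ, c u * b i ^ (u : ℤ) := by
    refine Finset.prod_congr rfl fun i _ => ?_
    rw [sum_units]; simp
  have h2 : ∀ s : ℤˣ, c s * Pspin r b s =
      ∑ ε ∈ Finset.univ.filter (fun ε : Fin r → ℤˣ => ∏ i, ε i = s),
        ∏ i, (c (ε i) * b i ^ (ε i : ℤ)) := by
    intro s
    rw [Pspin, Finset.mul_sum]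
    refine Finset.sum_congr rfl fun ε hε => ?_
    rw [Finset.prod_mul_distrib, ← map_prod, (Finset.mem_filter.1 hε).2]
  have h3 : Pspin r b 1 + c (-1) * Pspin r b (-1) = ∑ s : ℤˣ, c s * Pspin r b s := by
    rw [sum_units]; simp
  rw [h1, h3, Fintype.prod_sum]
  simp only [h2]
  exact (Finset.sum_fiberwise _ _ _).symm

/-- `P_+ · P_− = e_{r−1} + e_{r−3} + e_{r−5} + ⋯` (sum over all
nonnegative indices `r−1−2k`). -/
theorem stmt12 (r : ℕ) (hr : 1 ≤ r) (b : Fin r → ℂ) (hb : ∀ i, b i ≠ 0) :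
    Pspin r b 1 * Pspin r b (-1) =
      ∑ k ∈ Finset.range ((r + 1) / 2), esymm2r r b (r - 1 - 2 * k) := by
  have hA := spin_lin r b 1
  have hB := spin_lin r b ((Int.castRingHom ℂ : ℤ →* ℂ).comp (Units.coeHom ℤ))
  simp at hA hB
  have g1 := esymm_gen r b 1
  have g2 := esymm_gen r b (-1)
  have k1 : ∏ i, ((1 + 1 * b i ^ (2 : ℤ)) * (1 + 1 * b i ^ (-2 : ℤ))) =
      (Pspin r b 1 + Pspin r b (-1)) ^ 2 := by
    rw [← hA, ← Finset.prod_pow]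
    refine Finset.prod_congr rfl fun i _ => ?_
    have := hb i
    rw [zpow_neg, zpow_ofNat]
    field_simp
    ring
  have k2 : (-1) ^ r * ∏ i, ((1 + -1 * b i ^ (2 : ℤ)) * (1 + -1 * b i ^ (-2 : ℤ))) =
      (Pspin r b 1 + -Pspin r b (-1)) ^ 2 := by
    rw [← hB, ← Finset.prod_pow]
    have : ((-1 : ℂ)) ^ r = ∏ i : Fin r, (-1 : ℂ) := by simp
    rw [this, ← Finset.prod_mul_distrib]
    refine Finset.prod_congr rfl fun i _ => ?_
    have := hb i
    rw [zpow_neg, zpow_ofNat]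
    field_simp
    ring
  rw [g1] at k1
  rw [g2] at k2
  set e := esymm2r r b with he
  have key : 4 * (Pspin r b 1 * Pspin r b (-1)) =
      ∑ k ∈ Finset.range (2 * r + 1), (1 - (-1) ^ (r + k)) * e k := by
    have : 4 * (Pspin r b 1 * Pspin r b (-1)) =
      (Pspin r b 1 + Pspin r b (-1)) ^ 2 - (Pspin r b 1 + -Pspin r b (-1)) ^ 2 := by ring
    rw [this, ← k1, ← k2, Finset.mul_sum, ← Finset.sum_sub_distrib]
    refine Finset.sum_congr rfl fun k _ => ?_
    rw [pow_add]; ring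
  have hs : ∀ j < r, (1 - (-1 : ℂ) ^ (r + (r - 1 - j))) = 1 + (-1) ^ j := by
    intro j hj
    obtain ⟨m, rfl⟩ : ∃ m, r = m + j + 1 := ⟨r - 1 - j, by omega⟩
    have e1 : m + j + 1 + (m + j + 1 - 1 - j) = 2 * m + j + 1 := by omega
    rw [e1, pow_succ, pow_add, pow_mul]; simp
  have low : ∑ k ∈ Finset.range r, (1 - (-1) ^ (r + k)) * e k =
      ∑ j ∈ Finset.range r, (1 + (-1) ^ j) * e (r - 1 - j) := by
    rw [← Finset.sum_range_reflect]
    refine Finset.sum_congr rfl fun j hj => ?_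
    rw [hs j (Finset.mem_range.1 hj)]
  have high : ∑ j ∈ Finset.range r, (1 - (-1) ^ (r + (r + 1 + j))) * e (r + 1 + j) =
      ∑ j ∈ Finset.range r, (1 + (-1) ^ j) * e (r - 1 - j) := by
    refine Finset.sum_congr rfl fun j hj => ?_
    have hj := Finset.mem_range.1 hj
    have e1 : r + 1 + j = 2 * r - (r - 1 - j) := by omega
    have e2 : e (r + 1 + j) = e (r - 1 - j) := by
      rw [e1]; exact esymm_pal r b hb _ (by omega)
    have e3 : r + (r + 1 + j) = 2 * r + j + 1 := by omega
    rw [e2, e3, pow_succ, pow_add, pow_mul]; simp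
  have e4 : 2 * r + 1 = (r + 1) + r := by omega
  rw [e4, Finset.sum_range_add, Finset.sum_range_succ, low, high,
    sum_even (fun j => e (r - 1 - j)), ← two_mul r, pow_mul] at key
  norm_num at key
  linear_combination key / 4
end

section
/- (Jacobi's / Desnanot–Jacobi identity.) Let R be a commutative ring, n ≥ 2, and let M be an n×n matrix over R. Then det M[1;1] · det M[n;n] = det M · det M[1,n;1,n] + det M[1;n] · det M[n;1], where M[i;j] denotes the submatrix of M obtained by deleting row i and column j, and M[1,n;1,n] denotes the submatrix obtained by deleting rows 1 and n and columns 1 and n (whose determinant is taken to be 1 when n = 2). -/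
theorem jacobi_block {S m : Type*} [CommRing S] [IsDomain S] [Fintype m] [DecidableEq m]
    (M : Matrix (m ⊕ Fin 2) (m ⊕ Fin 2) S) (h : M.det ≠ 0) :
    M.adjugate.toBlocks₂₂.det = M.det * M.toBlocks₁₁.det := by
  have key : M * Matrix.fromBlocks 1 M.adjugate.toBlocks₁₂ 0 M.adjugate.toBlocks₂₂ =
      Matrix.fromBlocks M.toBlocks₁₁ 0 M.toBlocks₂₁ (M.det • 1) := by
    have h1 := M.mul_adjugate
    ext i j
    rcases j with j | j
    · rcases i with i | i <;>
        simp [Matrix.mul_apply, Matrix.one_apply, Matrix.toBlocks₁₁, Matrix.toBlocks₂₁]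
    · have h2 := congrFun (congrFun h1 i) (Sum.inr j)
      rcases i with i | i <;>
        simpa [Matrix.mul_apply, Matrix.one_apply, Matrix.toBlocks₁₂, Matrix.toBlocks₂₂] using h2
  have h3 := congrArg Matrix.det key
  rw [Matrix.det_mul, Matrix.det_fromBlocks_zero₂₁, Matrix.det_fromBlocks_zero₁₂,
    Matrix.det_one, one_mul, Matrix.det_smul, Matrix.det_one, Fintype.card_fin] at h3
  apply mul_left_cancel₀ h
  rw [h3]; ring

theorem jacobi_domain (R : Type*) [CommRing R] [IsDomain R] (n : ℕ)
    (M : Matrix (Fin (n + 2)) (Fin (n + 2)) R) (h : M.det ≠ 0) :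
    (M.submatrix (Fin.succAbove 0) (Fin.succAbove 0)).det *
      (M.submatrix (Fin.succAbove (Fin.last (n + 1)))
        (Fin.succAbove (Fin.last (n + 1)))).det =
    M.det * (M.submatrix (fun i : Fin n => i.succ.castSucc)
        (fun j : Fin n => j.succ.castSucc)).det +
      (M.submatrix (Fin.succAbove 0) (Fin.succAbove (Fin.last (n + 1)))).det *
        (M.submatrix (Fin.succAbove (Fin.last (n + 1))) (Fin.succAbove 0)).det := by
  let f : Fin n ⊕ Fin 2 → Fin (n + 2) :=
    Sum.elim (fun i => i.succ.castSucc) ![0, Fin.last (n + 1)]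
  have hf : Function.Bijective f := by
    rw [Fintype.bijective_iff_injective_and_card]
    refine ⟨?_, by simp⟩
    rintro (a | a) (b | b) hab
    · simpa [f] using hab
    · fin_cases b <;> simp [f, Fin.ext_iff] at hab <;> omega
    · fin_cases a <;> simp [f, Fin.ext_iff] at hab <;> omega
    · fin_cases a <;> fin_cases b <;> simp [f, Fin.ext_iff] at hab ⊢
  let e := Equiv.ofBijective f hf
  have hb := jacobi_block (M.submatrix e e) (by rwa [Matrix.det_submatrix_equiv_self])
  rw [Matrix.det_submatrix_equiv_self, Matrix.adjugate_submatrix_equiv_self,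
    Matrix.det_fin_two] at hb
  have h11 : (M.submatrix e e).toBlocks₁₁ = M.submatrix (fun i : Fin n => i.succ.castSucc)
        (fun j : Fin n => j.succ.castSucc) := rfl
  have e0 : e (Sum.inr 0) = 0 := rfl
  have e1 : e (Sum.inr 1) = Fin.last (n + 1) := rfl
  rw [h11] at hb
  simp only [Matrix.toBlocks₂₂, Matrix.of_apply, Matrix.submatrix_apply, e0, e1,
    Matrix.adjugate_fin_succ_eq_det_submatrix, Fin.val_zero, Fin.val_last, add_zero, zero_add,
    pow_zero, one_mul] at hb
  have hs : ((-1 : R) ^ (n + 1)) * (-1) ^ (n + 1) = 1 := by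
    rw [← mul_pow]; simp
  rw [pow_add (-1 : R) (n + 1) (n + 1)] at hb
  rw [← hb]
  linear_combination
    ((M.submatrix (Fin.succAbove 0) (Fin.succAbove (Fin.last (n + 1)))).det *
        (M.submatrix (Fin.succAbove (Fin.last (n + 1))) (Fin.succAbove 0)).det -
    (M.submatrix (Fin.succAbove 0) (Fin.succAbove 0)).det *
      (M.submatrix (Fin.succAbove (Fin.last (n + 1)))
        (Fin.succAbove (Fin.last (n + 1)))).det) * hs


/-- Desnanot–Jacobi identity: for an `(n+2)×(n+2)` matrix `M`
(covering all sizes `≥ 2`), with `M[i;j]` the submatrix deleting row `i` and column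
`j` (row/column `1` is index `0`, row/column `n+2` is `Fin.last`) and `M[1,n;1,n]`
the submatrix deleting the first and last rows and columns:
`det M[1;1] · det M[n;n] = det M · det M[1,n;1,n] + det M[1;n] · det M[n;1]`. -/
theorem stmt15 (R : Type*) [CommRing R] (n : ℕ)
    (M : Matrix (Fin (n + 2)) (Fin (n + 2)) R) :
    (M.submatrix (Fin.succAbove 0) (Fin.succAbove 0)).det *
      (M.submatrix (Fin.succAbove (Fin.last (n + 1)))
        (Fin.succAbove (Fin.last (n + 1)))).det =
    M.det * (M.submatrix (fun i : Fin n => i.succ.castSucc)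
        (fun j : Fin n => j.succ.castSucc)).det +
      (M.submatrix (Fin.succAbove 0) (Fin.succAbove (Fin.last (n + 1)))).det *
        (M.submatrix (Fin.succAbove (Fin.last (n + 1))) (Fin.succAbove 0)).det := by
  have hX := jacobi_domain (MvPolynomial (Fin (n + 2) × Fin (n + 2)) ℤ) n
    (Matrix.mvPolynomialX _ _ ℤ) (Matrix.det_mvPolynomialX_ne_zero _ _)
  have hM := Matrix.mvPolynomialX_mapMatrix_aeval ℤ M
  have h := congrArg (MvPolynomial.aeval (R := ℤ)
    fun p : Fin (n + 2) × Fin (n + 2) => M p.1 p.2) hX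
  simp only [map_mul, map_add, AlgHom.map_det] at h
  rw [hM] at h
  have hs : ∀ (k : ℕ) (r c : Fin k → Fin (n + 2)),
      (MvPolynomial.aeval (R := ℤ) fun p : Fin (n + 2) × Fin (n + 2) => M p.1 p.2).mapMatrix
        ((Matrix.mvPolynomialX (Fin (n + 2)) (Fin (n + 2)) ℤ).submatrix r c) =
        M.submatrix r c := by
    intro k r c
    ext i j
    simp
  simpa only [hs] using h
end
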